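/- arXiv:1305.2592 — 2 statements merged into one kernel-verified Lean document; each statement's English description precedes it below -/
import Mathlib

section
/- Let M ≥ 3 be an integer, let h ∈ ℂ^M be a fixed unit vector, and let B be a random unitary M×M matrix distributed according to the Haar probability measure on the unitary group U(M). Let b₁, b₂ denote the first two columns of B, and define the random variable r = √(|⟨b₁, h⟩|² + |⟨b₂, h⟩|²). Then r has probability density on (0,1) given by f_M(u) = 2(M−1)(M−2) u³ (1−u²)^{M−3}; that is, for every Borel set A ⊆ ℝ, Prob(r ∈ A) = ∫_{A ∩ (0,1)} f_M(u) du. -/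
open MeasureTheory

theorem hp_radial {E : Type*} [NormedAddCommGroup E] [NormedSpace ℝ E] [MeasurableSpace E]
    [BorelSpace E] [FiniteDimensional ℝ E] [Nontrivial E] (μ : Measure E) [μ.IsAddHaarMeasure]
    (f : ℝ → ENNReal) (hf : Measurable f) :
    ∫⁻ x, f ‖x‖ ∂μ = μ.toSphere Set.univ *
      ∫⁻ y in Set.Ioi (0:ℝ), ENNReal.ofReal (y ^ (Module.finrank ℝ E - 1)) * f y := by
  calc ∫⁻ x, f ‖x‖ ∂μ = ∫⁻ x in ({0}ᶜ : Set E), f ‖x‖ ∂μ := by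
        rw [Measure.restrict_eq_self_of_ae_mem]
        exact compl_mem_ae_iff.2 (by simp)
    _ = ∫⁻ x : ({(0)}ᶜ : Set E), f (‖x.1‖) ∂(μ.comap (↑)) := by
        rw [lintegral_subtype_comap (measurableSet_singleton _).compl fun x ↦ f (‖x‖)]
    _ = ∫⁻ x, f x.2 ∂μ.toSphere.prod (.volumeIoiPow (Module.finrank ℝ E - 1)) := by
        simpa using μ.measurePreserving_homeomorphUnitSphereProd.lintegral_comp
          (f := f ∘ Subtype.val ∘ Prod.snd) (by fun_prop)
    _ = ∫⁻ x : Metric.sphere (0:E) 1, ∫⁻ y : Set.Ioi (0 : ℝ), f y ∂.volumeIoiPow (Module.finrank ℝ E - 1) ∂μ.toSphere := by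
        rw [lintegral_prod _ (by fun_prop)]
    _ = _ := by
        rw [lintegral_const, mul_comm, Measure.volumeIoiPow,
          lintegral_withDensity_eq_lintegral_mul _ (by fun_prop) (by fun_prop)]
        congr 1
        rw [← lintegral_subtype_comap measurableSet_Ioi]
        rfl

theorem hp_prod {E F : Type*} [NormedAddCommGroup E] [NormedSpace ℝ E] [MeasurableSpace E]
    [BorelSpace E] [FiniteDimensional ℝ E] [Nontrivial E] (μ : Measure E) [μ.IsAddHaarMeasure]
    [NormedAddCommGroup F] [NormedSpace ℝ F] [MeasurableSpace F]
    [BorelSpace F] [FiniteDimensional ℝ F] [Nontrivial F] (ν : Measure F) [ν.IsAddHaarMeasure]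
    (f : ℝ × ℝ → ENNReal) (hf : Measurable f) :
    ∫⁻ z, f (‖z.1‖, ‖z.2‖) ∂(μ.prod ν) = μ.toSphere Set.univ * ν.toSphere Set.univ *
      ∫⁻ p : ℝ × ℝ, (Set.Ioi 0 ×ˢ Set.Ioi 0).indicator
        (fun p => ENNReal.ofReal (p.1 ^ (Module.finrank ℝ E - 1)) *
          ENNReal.ofReal (p.2 ^ (Module.finrank ℝ F - 1)) * f p) p := by
  rw [lintegral_prod _ (by fun_prop)]
  have h1 : ∀ x : E, ∫⁻ y, f (‖x‖, ‖y‖) ∂ν = ν.toSphere Set.univ *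
      ∫⁻ y in Set.Ioi (0:ℝ), ENNReal.ofReal (y ^ (Module.finrank ℝ F - 1)) * f (‖x‖, y) :=
    fun x => hp_radial ν (fun y => f (‖x‖, y)) (by fun_prop)
  simp only [h1]
  have hm : Measurable fun x => ∫⁻ y in Set.Ioi (0:ℝ),
      ENNReal.ofReal (y ^ (Module.finrank ℝ F - 1)) * f (x, y) :=
    Measurable.lintegral_prod_right (f := fun x y : ℝ => ENNReal.ofReal (y ^ (Module.finrank ℝ F - 1)) * f (x, y)) (by unfold Function.uncurry; fun_prop)
  rw [lintegral_const_mul _ (show Measurable fun x : E => ∫⁻ y in Set.Ioi (0:ℝ),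
      ENNReal.ofReal (y ^ (Module.finrank ℝ F - 1)) * f (‖x‖, y) from hm.comp measurable_norm)]
  rw [hp_radial μ _ hm, ← mul_assoc, mul_comm (ν.toSphere _)]
  congr 1
  rw [lintegral_indicator (measurableSet_Ioi.prod measurableSet_Ioi), Measure.volume_eq_prod,
    ← Measure.prod_restrict, lintegral_prod _ (by fun_prop)]
  refine lintegral_congr fun x => ?_
  rw [← lintegral_const_mul _ (by fun_prop)]
  simp only [mul_assoc]

theorem hp_polar (n : ℕ) (A : Set ℝ) (hA : MeasurableSet A) :
    ∫⁻ p : ℝ × ℝ, (Set.Ioi 0 ×ˢ Set.Ioi 0).indicator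
        (fun p => ENNReal.ofReal (p.1 ^ 3) * ENNReal.ofReal (p.2 ^ (2 * n + 1)) *
          ({p : ℝ × ℝ | p.1 ^ 2 + p.2 ^ 2 ≤ 1 ∧
            p.1 / Real.sqrt (p.1 ^ 2 + p.2 ^ 2) ∈ A}).indicator (fun _ => 1) p) p
    = (∫⁻ ρ : ℝ, (Set.Ioc 0 1).indicator (fun ρ => ENNReal.ofReal (ρ ^ (2 * n + 5))) ρ) *
      ∫⁻ u in A ∩ Set.Ioo 0 1, ENNReal.ofReal (u ^ 3 * (1 - u ^ 2) ^ n) := by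
  classical
  have himg : Real.cos '' Set.Ioo 0 (Real.pi / 2) = Set.Ioo 0 1 := by
    ext u
    constructor
    · rintro ⟨θ, ⟨h1, h2⟩, rfl⟩
      refine ⟨Real.cos_pos_of_mem_Ioo ⟨by linarith, h2⟩, ?_⟩
      rw [← Real.cos_zero]
      exact Real.cos_lt_cos_of_nonneg_of_le_pi le_rfl (by linarith [Real.pi_pos]) h1
    · rintro ⟨h1, h2⟩
      exact ⟨Real.arccos u, ⟨Real.arccos_pos.2 h2, Real.arccos_lt_pi_div_two.2 h1⟩,
        Real.cos_arccos (by linarith) h2.le⟩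
  have hsub : ∫⁻ u in A ∩ Set.Ioo 0 1, ENNReal.ofReal (u ^ 3 * (1 - u ^ 2) ^ n) =
      ∫⁻ θ : ℝ, (Set.Ioo 0 (Real.pi / 2)).indicator (fun θ =>
        ENNReal.ofReal (Real.sin θ) * A.indicator
          (fun u => ENNReal.ofReal (u ^ 3 * (1 - u ^ 2) ^ n)) (Real.cos θ)) θ := by
    rw [lintegral_indicator measurableSet_Ioo, Set.inter_comm, ← Measure.restrict_restrict_of_subset
      Set.inter_subset_left, Measure.restrict_restrict (measurableSet_Ioo.inter hA)]
    rw [show (Set.Ioo (0:ℝ) 1 ∩ A) ∩ Set.Ioo 0 1 = A ∩ Set.Ioo 0 1 by ext; simp; tauto,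
      ← Measure.restrict_restrict hA, ← lintegral_indicator hA, ← himg,
      lintegral_image_eq_lintegral_abs_deriv_mul measurableSet_Ioo
        (fun x _ => (Real.hasDerivAt_cos x).hasDerivWithinAt)
        (Real.injOn_cos.mono (fun x hx => ⟨hx.1.le, by linarith [hx.2, Real.pi_pos]⟩ :
          Set.Ioo 0 (Real.pi / 2) ⊆ Set.Icc 0 Real.pi))]
    refine setLIntegral_congr_fun measurableSet_Ioo fun θ hθ => ?_
    have : 0 < Real.sin θ := Real.sin_pos_of_pos_of_lt_pi hθ.1 (by linarith [hθ.2, Real.pi_pos])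
    simp only [abs_neg, abs_of_pos this]
  rw [hsub, ← lintegral_prod_mul, ← lintegral_comp_polarCoord_symm, ← Measure.volume_eq_prod]
  rotate_left
  · exact (Measurable.indicator (by fun_prop) measurableSet_Ioc).aemeasurable
  · refine (Measurable.indicator ?_ measurableSet_Ioo).aemeasurable
    exact (by fun_prop : Measurable fun θ => ENNReal.ofReal (Real.sin θ)).mul
      ((Measurable.indicator (by fun_prop) hA).comp Real.measurable_cos)
  rw [← lintegral_indicator polarCoord.open_target.measurableSet]
  refine lintegral_congr fun p => ?_
  obtain ⟨ρ, θ⟩ := p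
  simp only [polarCoord_target, polarCoord_symm_apply]
  by_cases hρ : 0 < ρ
  swap
  · rw [Set.indicator_of_notMem (by simp; tauto), Set.indicator_of_notMem (by simp; tauto)]; simp
  by_cases hθ : θ ∈ Set.Ioo 0 (Real.pi / 2)
  · have hs : 0 < Real.sin θ := Real.sin_pos_of_pos_of_lt_pi hθ.1 (by linarith [hθ.2, Real.pi_pos])
    have hc : 0 < Real.cos θ := Real.cos_pos_of_mem_Ioo ⟨by linarith [hθ.1, Real.pi_pos], hθ.2⟩
    have e1 : (ρ * Real.cos θ) ^ 2 + (ρ * Real.sin θ) ^ 2 = ρ ^ 2 := by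
      have := Real.sin_sq_add_cos_sq θ
      linear_combination ρ ^ 2 * this
    rw [Set.indicator_of_mem (by
      refine ⟨hρ, ?_, ?_⟩ <;> simp only <;> linarith [hθ.1, hθ.2, Real.pi_pos])]
    rw [Set.indicator_of_mem (by constructor <;> simp <;> positivity)]
    rw [Set.indicator_of_mem hθ]
    have e2 : ρ * Real.cos θ / ρ = Real.cos θ := by field_simp
    simp only [Set.indicator_apply, Set.mem_ofPred_eq, e1, Real.sqrt_sq hρ.le, e2, Set.mem_Ioc,
      smul_eq_mul, hρ, true_and]
    have e3 : ρ ^ 2 ≤ 1 ↔ ρ ≤ 1 := by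
      rw [sq_le_one_iff₀ hρ.le]
    by_cases h1 : ρ ≤ 1 <;> by_cases h2 : Real.cos θ ∈ A <;> simp [h1, h2, e3]
    have e4 : 1 - Real.cos θ ^ 2 = Real.sin θ ^ 2 := by linarith [Real.sin_sq_add_cos_sq θ]
    rw [e4, ← ENNReal.ofReal_mul (by positivity), ← ENNReal.ofReal_mul (by positivity),
       ← ENNReal.ofReal_mul (by positivity), ← ENNReal.ofReal_mul (by positivity)]
    congr 1
    ring
  · rw [Set.indicator_of_notMem (s := Set.Ioo 0 (Real.pi / 2)) hθ, mul_zero]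
    by_cases hθ' : θ ∈ Set.Ioo (-Real.pi) Real.pi
    swap
    · rw [Set.indicator_of_notMem (by simp at *; tauto)]
    rw [Set.indicator_of_mem (by exact ⟨hρ, hθ'⟩), Set.indicator_of_notMem]
    · simp
    rintro ⟨h1, h2⟩
    simp only [Set.mem_Ioi, hρ, mul_pos_iff_of_pos_left] at h1 h2
    apply hθ
    constructor
    · by_contra h
      linarith [Real.sin_nonpos_of_nonpos_of_neg_pi_le (by linarith : θ ≤ 0) hθ'.1.le]
    · by_contra h
      linarith [Real.cos_nonpos_of_pi_div_two_le_of_le (by linarith : Real.pi / 2 ≤ θ) (by linarith [hθ'.2, Real.pi_pos])]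

noncomputable def hpN {n : ℕ} (v : Fin n → ℂ) : ℝ := ∑ k, ‖v k‖ ^ 2

noncomputable def hpPhi {n : ℕ} (v : Fin (n + 3) → ℂ) : ℝ :=
  Real.sqrt (‖v 0‖ ^ 2 + ‖v 1‖ ^ 2) / Real.sqrt (hpN v)

theorem hp_meas_N {n : ℕ} : Measurable (hpN (n := n)) := by
  unfold hpN; fun_prop

theorem hp_meas_Phi {n : ℕ} : Measurable (hpPhi (n := n)) := by
  have := hp_meas_N (n := n + 3)
  unfold hpPhi; fun_prop

noncomputable def hpL (n : ℕ) : (EuclideanSpace ℂ (Fin 2) × EuclideanSpace ℂ (Fin (n + 1))) ≃ₗ[ℝ]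
    (Fin (n + 3) → ℂ) where
  toFun z := Fin.cons (z.1 0) (Fin.cons (z.1 1) (fun k => z.2 k))
  invFun v := (!₂[v 0, v 1], WithLp.toLp 2 fun k => v k.succ.succ)
  map_add' x y := by
    ext k
    refine Fin.cases ?_ (fun k => Fin.cases ?_ (fun k => ?_) k) k <;> simp
  map_smul' c x := by
    ext k
    refine Fin.cases ?_ (fun k => Fin.cases ?_ (fun k => ?_) k) k <;> simp
  left_inv z := by
    ext k
    · fin_cases k
      · simp
      · rfl
    · simp
  right_inv v := by
    ext k
    refine Fin.cases ?_ (fun k => Fin.cases ?_ (fun k => ?_) k) k <;> simp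

theorem hp_finrank (k : ℕ) : Module.finrank ℝ (EuclideanSpace ℂ (Fin k)) = 2 * k := by
  rw [← Module.finrank_mul_finrank ℝ ℂ]
  simp

theorem hp_haar (n : ℕ) : ∃ lam : Measure (Fin (n + 3) → ℂ), lam.IsAddHaarMeasure ∧
    ∃ C : ENNReal, ∀ A : Set ℝ, MeasurableSet A →
      lam {v | hpN v ≤ 1 ∧ hpPhi v ∈ A} =
        C * ∫⁻ u in A ∩ Set.Ioo 0 1, ENNReal.ofReal (u ^ 3 * (1 - u ^ 2) ^ n) := by
  classical
  let μ : Measure (EuclideanSpace ℂ (Fin 2)) := Measure.addHaar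
  let ν : Measure (EuclideanSpace ℂ (Fin (n + 1))) := Measure.addHaar
  refine ⟨(μ.prod ν).map (hpL n).toContinuousLinearEquiv, inferInstance, ?_⟩
  refine ⟨μ.toSphere Set.univ * ν.toSphere Set.univ * (∫⁻ ρ : ℝ, (Set.Ioc 0 1).indicator (fun ρ => ENNReal.ofReal (ρ ^ (2 * n + 5))) ρ), fun A hA => ?_⟩
  have hS : MeasurableSet {v : Fin (n + 3) → ℂ | hpN v ≤ 1 ∧ hpPhi v ∈ A} :=
    (measurableSet_le hp_meas_N measurable_const).inter (hp_meas_Phi hA)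
  rw [Measure.map_apply (hpL n).toContinuousLinearEquiv.continuous.measurable hS]
  have hS' : MeasurableSet {p : ℝ × ℝ | p.1 ^ 2 + p.2 ^ 2 ≤ 1 ∧
            p.1 / Real.sqrt (p.1 ^ 2 + p.2 ^ 2) ∈ A} :=
    (measurableSet_le (f := fun p : ℝ × ℝ => p.1 ^ 2 + p.2 ^ 2) (by fun_prop)
      measurable_const).inter ((by fun_prop : Measurable fun p : ℝ × ℝ => p.1 / Real.sqrt (p.1 ^ 2 + p.2 ^ 2)) hA)
  have key := hp_prod μ ν (({p : ℝ × ℝ | p.1 ^ 2 + p.2 ^ 2 ≤ 1 ∧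
            p.1 / Real.sqrt (p.1 ^ 2 + p.2 ^ 2) ∈ A}).indicator (fun _ => 1))
            (measurable_const.indicator hS')
  rw [hp_finrank, hp_finrank, show 2 * 2 - 1 = 3 from rfl,
    show 2 * (n + 1) - 1 = 2 * n + 1 by omega, hp_polar n A hA] at key
  rw [mul_assoc (μ.toSphere Set.univ * _), ← key, ← lintegral_indicator_one
    ((hpL n).toContinuousLinearEquiv.continuous.measurable hS)]
  refine lintegral_congr fun z => ?_
  have h0 : ‖hpL n z 0‖ ^ 2 + ‖hpL n z 1‖ ^ 2 = ‖z.1‖ ^ 2 := by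
    rw [EuclideanSpace.norm_sq_eq, Fin.sum_univ_two]
    rfl
  have h1 : hpN (hpL n z) = ‖z.1‖ ^ 2 + ‖z.2‖ ^ 2 := by
    rw [← h0, EuclideanSpace.norm_sq_eq z.2, hpN, Fin.sum_univ_succ, Fin.sum_univ_succ, ← add_assoc]
    rfl
  have h2 : hpPhi (hpL n z) = ‖z.1‖ / Real.sqrt (‖z.1‖ ^ 2 + ‖z.2‖ ^ 2) := by
    rw [hpPhi, h0, h1, Real.sqrt_sq (norm_nonneg _)]
  simp only [Set.indicator_apply, Set.mem_preimage, Set.mem_ofPred_eq,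
    LinearEquiv.coe_toContinuousLinearEquiv', h1, h2, Pi.one_apply]

theorem hp_N_eq {m : ℕ} (v : Fin m → ℂ) : hpN v = ‖(WithLp.toLp 2 v : EuclideanSpace ℂ (Fin m))‖ ^ 2 := by
  rw [EuclideanSpace.norm_sq_eq]; rfl

theorem hp_N_dot {m : ℕ} (v : Fin m → ℂ) : (hpN v : ℂ) = star v ⬝ᵥ v := by
  simp [hpN, dotProduct, ← Complex.normSq_eq_norm_sq, Complex.normSq_eq_conj_mul_self]

theorem hp_N_unitary {m : ℕ} (g : Matrix (Fin m) (Fin m) ℂ) (hg : g ∈ Matrix.unitaryGroup (Fin m) ℂ)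
    (v : Fin m → ℂ) : hpN (g.mulVec v) = hpN v := by
  have : (hpN (g.mulVec v) : ℂ) = hpN v := by
    rw [hp_N_dot, hp_N_dot, Matrix.star_mulVec, Matrix.dotProduct_mulVec, Matrix.vecMul_vecMul,
      ← Matrix.star_eq_conjTranspose, Matrix.mem_unitaryGroup_iff'.1 hg, Matrix.vecMul_one]
  exact_mod_cast this

theorem hp_ball {m : ℕ} (lam : Measure (Fin m → ℂ)) [lam.IsAddHaarMeasure] :
    lam {v | hpN v ≤ 1} ≠ 0 ∧ lam {v | hpN v ≤ 1} ≠ ⊤ := by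
  have hc : Continuous (hpN (n := m)) := by unfold hpN; fun_prop
  constructor
  · have h1 : IsOpen {v : Fin m → ℂ | hpN v < 1} := isOpen_lt hc continuous_const
    have := h1.measure_ne_zero lam ⟨0, by simp [hpN]⟩
    intro h
    exact this (measure_mono_null (t := {v | hpN v ≤ 1}) (fun v hv => le_of_lt (Set.mem_ofPred_eq ▸ hv)) h)
  · apply ne_of_lt
    apply Bornology.IsBounded.measure_lt_top
    refine (Metric.isBounded_closedBall (x := (0 : Fin m → ℂ)) (r := 1)).subset fun v hv => ?_
    rw [mem_closedBall_zero_iff, pi_norm_le_iff_of_nonneg zero_le_one]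
    intro i
    have : ‖v i‖ ^ 2 ≤ 1 := le_trans (Finset.single_le_sum (f := fun k => ‖v k‖ ^ 2) (fun k _ => by positivity) (Finset.mem_univ i)) hv
    exact (sq_le_one_iff₀ (norm_nonneg _)).1 this

theorem hp_inv {m : ℕ} (lam : Measure (Fin m → ℂ)) [lam.IsAddHaarMeasure]
    (g : Matrix (Fin m) (Fin m) ℂ) (hg : g ∈ Matrix.unitaryGroup (Fin m) ℂ) :
    lam.map (fun v => g.mulVec v) = lam := by
  let e : (Fin m → ℂ) ≃ₗ[ℂ] (Fin m → ℂ) := LinearEquiv.ofLinearMap g.mulVecLin (star g).mulVecLin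
    (by rw [← Matrix.mulVecLin_mul, Matrix.mem_unitaryGroup_iff.1 hg, Matrix.mulVecLin_one])
    (by rw [← Matrix.mulVecLin_mul, Matrix.mem_unitaryGroup_iff'.1 hg, Matrix.mulVecLin_one])
  let e' := e.toContinuousLinearEquiv
  have he : (fun v => g.mulVec v) = e' := rfl
  have hm : Measurable fun v : Fin m → ℂ => g.mulVec v := by
    rw [he]; exact e'.continuous.measurable
  have h1 : (lam.map e').IsAddHaarMeasure := inferInstance
  rw [← he] at h1
  have h2 := Measure.isAddLeftInvariant_eq_smul (lam.map (fun v => g.mulVec v)) lam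
  have h3 : (lam.map (fun v => g.mulVec v)) {v | hpN v ≤ 1} = lam {v | hpN v ≤ 1} := by
    rw [Measure.map_apply hm (measurableSet_le hp_meas_N measurable_const)]
    congr 1
    ext v
    simp [hp_N_unitary g hg]
  obtain ⟨hb0, hb1⟩ := hp_ball lam
  rw [h2] at h3 ⊢
  rw [Measure.smul_apply, ENNReal.smul_def, smul_eq_mul] at h3
  have h4 := (ENNReal.mul_eq_right hb0 hb1).1 h3
  have h5 : Measure.addHaarScalarFactor (lam.map (fun v => g.mulVec v)) lam = 1 := by exact_mod_cast h4
  rw [h5, one_smul]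

theorem hp_col {m : ℕ} (w : Fin (m + 1) → ℂ) (hw : hpN w = 1) :
    ∃ g ∈ Matrix.unitaryGroup (Fin (m + 1)) ℂ, g.mulVec (Pi.single 0 1) = w := by
  have hw' : ‖(WithLp.toLp 2 w : EuclideanSpace ℂ (Fin (m + 1)))‖ = 1 := by
    rw [hp_N_eq] at hw
    exact (pow_eq_one_iff_of_nonneg (norm_nonneg _) two_ne_zero).1 hw
  have ho : Orthonormal ℂ (Set.domRestrict {(0 : Fin (m + 1))}
      (fun _ => (WithLp.toLp 2 w : EuclideanSpace ℂ (Fin (m + 1))))) := by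
    constructor
    · intro i; exact hw'
    · intro i j hij; exact absurd (Subsingleton.elim i j) hij
  obtain ⟨b, hb⟩ := ho.exists_orthonormalBasis_extension_of_card_eq (by simp)
  refine ⟨(EuclideanSpace.basisFun (Fin (m + 1)) ℂ).toBasis.toMatrix b,
    OrthonormalBasis.toMatrix_orthonormalBasis_mem_unitary _ _, ?_⟩
  ext i
  simp [Module.Basis.toMatrix_apply, hb 0 rfl]

theorem hp_trans {m : ℕ} (h w : Fin (m + 1) → ℂ) (hh : hpN h = 1) (hw : hpN w = 1) :
    ∃ g : Matrix.unitaryGroup (Fin (m + 1)) ℂ, (g : Matrix _ _ ℂ).mulVec h = w := by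
  obtain ⟨a, ha, ha'⟩ := hp_col h hh
  obtain ⟨b, hb, hb'⟩ := hp_col w hw
  refine ⟨⟨b, hb⟩ * star ⟨a, ha⟩, ?_⟩
  rw [← ha', ← hb']
  change (b * star a).mulVec _ = _
  rw [Matrix.mulVec_mulVec, Matrix.mul_assoc, Matrix.mem_unitaryGroup_iff'.1 ha, Matrix.mul_one]

theorem hp_N_smul {m : ℕ} (c : ℝ) (v : Fin m → ℂ) : hpN (c • v) = c ^ 2 * hpN v := by
  simp [hpN, Finset.mul_sum, mul_pow]

theorem hp_Phi_smul {n : ℕ} (c : ℝ) (hc : 0 < c) (v : Fin (n + 3) → ℂ) :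
    hpPhi (c • v) = hpPhi v := by
  have : ‖(c • v) 0‖ ^ 2 + ‖(c • v) 1‖ ^ 2 = c ^ 2 * (‖v 0‖ ^ 2 + ‖v 1‖ ^ 2) := by
    simp [mul_pow, mul_add]
  rw [hpPhi, hpPhi, this, hp_N_smul, Real.sqrt_mul (by positivity), Real.sqrt_mul (by positivity),
    Real.sqrt_sq hc.le, mul_div_mul_left _ _ hc.ne']

set_option maxHeartbeats 1000000 in
theorem hp_avg (n : ℕ) (h : Fin (n + 3) → ℂ) (hh : hpN h = 1)
    [MeasurableSpace (Matrix.unitaryGroup (Fin (n + 3)) ℂ)]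
    [BorelSpace (Matrix.unitaryGroup (Fin (n + 3)) ℂ)]
    (μ : Measure (Matrix.unitaryGroup (Fin (n + 3)) ℂ)) [IsProbabilityMeasure μ]
    (hinv : ∀ g : Matrix.unitaryGroup (Fin (n + 3)) ℂ,
      Measure.map (fun B => g * B) μ = μ)
    (lam : Measure (Fin (n + 3) → ℂ)) [lam.IsAddHaarMeasure]
    (A : Set ℝ) (hA : MeasurableSet A) :
    μ {B | hpPhi ((star (B : Matrix (Fin (n + 3)) (Fin (n + 3)) ℂ)).mulVec h) ∈ A} *
      lam {v | hpN v ≤ 1} = lam {v | hpN v ≤ 1 ∧ hpPhi v ∈ A} := by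
  let D : Set (Fin (n + 3) → ℂ) := {v | hpN v ≤ 1}
  have hD : MeasurableSet D := measurableSet_le hp_meas_N measurable_const
  have hent : ∀ i j, Measurable fun B : Matrix.unitaryGroup (Fin (n + 3)) ℂ =>
      (B : Matrix (Fin (n + 3)) (Fin (n + 3)) ℂ) i j := fun i j =>
    (Continuous.matrix_elem continuous_subtype_val i j).measurable
  have hT : Measurable fun p : Matrix.unitaryGroup (Fin (n + 3)) ℂ × (Fin (n + 3) → ℂ) =>
      (star (p.1 : Matrix (Fin (n + 3)) (Fin (n + 3)) ℂ)).mulVec p.2 := by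
    refine measurable_pi_lambda _ fun j => ?_
    simp only [Matrix.mulVec, dotProduct, Matrix.star_apply]
    refine Finset.measurable_sum _ fun k _ => Measurable.mul ?_ (by fun_prop)
    exact continuous_star.measurable.comp ((hent k j).comp measurable_fst)
  let S : Set (Matrix.unitaryGroup (Fin (n + 3)) ℂ × (Fin (n + 3) → ℂ)) :=
    {p | hpPhi ((star (p.1 : Matrix (Fin (n + 3)) (Fin (n + 3)) ℂ)).mulVec p.2) ∈ A}
  have hS : MeasurableSet S := (hp_meas_Phi.comp hT) hA
  have hconst : ∀ v : Fin (n + 3) → ℂ, v ≠ 0 → μ ((fun B => (B, v)) ⁻¹' S) =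
      μ ((fun B => (B, h)) ⁻¹' S) := by
    intro v hv
    have hN : 0 < hpN v := by
      rw [hp_N_eq]
      have : WithLp.toLp 2 v ≠ 0 := by simpa using hv
      positivity
    have hs : 0 < (Real.sqrt (hpN v))⁻¹ := by positivity
    obtain ⟨g, hg⟩ := hp_trans h ((Real.sqrt (hpN v))⁻¹ • v) hh (by
      rw [hp_N_smul, inv_pow, Real.sq_sqrt hN.le, inv_mul_cancel₀ hN.ne'])
    have hgm : Measurable fun B => star g * B := by
      have : Continuous fun B => star g * B := by fun_prop
      exact this.measurable
    conv_rhs => rw [← hinv (star g), Measure.map_apply hgm (measurable_prodMk_right hS)]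
    congr 1
    ext B
    simp only [Set.mem_preimage, S, Set.mem_ofPred_eq]
    have : (star ((star g * B : Matrix.unitaryGroup (Fin (n + 3)) ℂ) :
        Matrix (Fin (n + 3)) (Fin (n + 3)) ℂ)).mulVec h =
        (Real.sqrt (hpN v))⁻¹ • (star (B : Matrix (Fin (n + 3)) (Fin (n + 3)) ℂ)).mulVec v := by
      rw [← Matrix.mulVec_smul, ← hg, Matrix.mulVec_mulVec]
      congr 1
      simp
    rw [this, hp_Phi_smul _ hs]
  have e1 : (μ.prod (lam.restrict D)) S = μ ((fun B => (B, h)) ⁻¹' S) * lam D := by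
    rw [Measure.prod_apply_symm hS]
    rw [lintegral_congr_ae (g := fun _ => μ ((fun B => (B, h)) ⁻¹' S))]
    · simp
    · refine ae_restrict_of_ae ?_
      have : ∀ᵐ v ∂lam, v ≠ 0 := by
        rw [ae_iff]; simp
      filter_upwards [this] with v hv using hconst v hv
  have e2 : (μ.prod (lam.restrict D)) S = lam {v | hpN v ≤ 1 ∧ hpPhi v ∈ A} := by
    rw [Measure.prod_apply hS]
    have : ∀ B : Matrix.unitaryGroup (Fin (n + 3)) ℂ, lam.restrict D (Prod.mk B ⁻¹' S) =
        lam {v | hpN v ≤ 1 ∧ hpPhi v ∈ A} := by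
      intro B
      have hB : star (B : Matrix (Fin (n + 3)) (Fin (n + 3)) ℂ) ∈
        Matrix.unitaryGroup (Fin (n + 3)) ℂ := (star B).2
      have hTB : Measurable fun v : Fin (n + 3) → ℂ =>
          (star (B : Matrix (Fin (n + 3)) (Fin (n + 3)) ℂ)).mulVec v :=
        (LinearMap.continuous_of_finiteDimensional 
          (Matrix.mulVecLin (star (B : Matrix (Fin (n + 3)) (Fin (n + 3)) ℂ)))).measurable
      have hE : MeasurableSet {v : Fin (n + 3) → ℂ | hpN v ≤ 1 ∧ hpPhi v ∈ A} :=
        hD.inter (hp_meas_Phi hA)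
      conv_rhs => rw [← hp_inv lam _ hB]
      rw [Measure.restrict_apply (measurable_prodMk_left hS), Measure.map_apply hTB hE]
      · congr 1
        ext v
        simp only [Set.mem_inter_iff, Set.mem_preimage, S, D, Set.mem_ofPred_eq, hp_N_unitary _ hB]
        exact and_comm
    simp [this]
  exact e1.symm.trans e2

theorem hp_total (n : ℕ) : ∫ u in Set.Ioo (0:ℝ) 1,
    2 * ((n:ℝ) + 2) * ((n:ℝ) + 1) * u ^ 3 * (1 - u ^ 2) ^ n = 1 := by
  rw [← integral_Ioc_eq_integral_Ioo, ← intervalIntegral.integral_of_le zero_le_one]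
  have hd : ∀ u : ℝ, HasDerivAt (fun u : ℝ => ((n:ℝ) + 1) * (1 - u ^ 2) ^ (n + 2)
      - ((n:ℝ) + 2) * (1 - u ^ 2) ^ (n + 1))
      (2 * ((n:ℝ) + 2) * ((n:ℝ) + 1) * u ^ 3 * (1 - u ^ 2) ^ n) u := by
    intro u
    have h1 : HasDerivAt (fun u : ℝ => 1 - u ^ 2) (-(2 * u)) u := by
      simpa using (hasDerivAt_pow 2 u).const_sub 1
    refine (((h1.fun_pow (n + 2)).const_mul ((n:ℝ) + 1)).sub
      ((h1.fun_pow (n + 1)).const_mul ((n:ℝ) + 2))).congr_deriv ?_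
    rw [show n + 2 - 1 = n + 1 by omega, show n + 1 - 1 = n by omega]
    push_cast
    ring
  rw [intervalIntegral.integral_eq_sub_of_hasDerivAt (fun u _ => hd u)
    (Continuous.intervalIntegrable (by fun_prop) _ _)]
  norm_num

/-- Let `M ≥ 3`, let `h ∈ ℂ^M` be a fixed unit vector, and let `B` be a random
unitary `M×M` matrix distributed according to the Haar probability measure on `U(M)`
(characterized as a Borel probability measure invariant under left translation). With
`b₁, b₂` the first two columns of `B` and `r = √(|⟨b₁, h⟩|² + |⟨b₂, h⟩|²)`, the random
variable `r` has probability density `f_M(u) = 2(M−1)(M−2) u³ (1−u²)^{M−3}` on `(0,1)`: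
for every Borel set `A ⊆ ℝ`, `Prob(r ∈ A) = ∫_{A ∩ (0,1)} f_M(u) du`. -/
theorem haar_projection_norm_density (M : ℕ) (hM : 3 ≤ M)
    (h : Fin M → ℂ) (hh : ∑ k, ‖h k‖ ^ 2 = 1)
    [MeasurableSpace (Matrix.unitaryGroup (Fin M) ℂ)]
    [BorelSpace (Matrix.unitaryGroup (Fin M) ℂ)]
    (μ : Measure (Matrix.unitaryGroup (Fin M) ℂ)) [IsProbabilityMeasure μ]
    (hinv : ∀ g : Matrix.unitaryGroup (Fin M) ℂ,
      Measure.map (fun B => g * B) μ = μ)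
    (r : Matrix.unitaryGroup (Fin M) ℂ → ℝ)
    (hr : ∀ B, r B = Real.sqrt
      (‖∑ k, (starRingEnd ℂ)
          ((B : Matrix (Fin M) (Fin M) ℂ) k ⟨0, by omega⟩) * h k‖ ^ 2
        + ‖∑ k, (starRingEnd ℂ)
          ((B : Matrix (Fin M) (Fin M) ℂ) k ⟨1, by omega⟩) * h k‖ ^ 2))
    (A : Set ℝ) (hA : MeasurableSet A) :
    μ {B | r B ∈ A} = ENNReal.ofReal (∫ u in A ∩ Set.Ioo (0:ℝ) 1,
      2 * ((M:ℝ) - 1) * ((M:ℝ) - 2) * u ^ 3 * (1 - u ^ 2) ^ (M - 3)) := by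
  obtain ⟨n, rfl⟩ : ∃ n, M = n + 3 := ⟨M - 3, by omega⟩
  have hr' : ∀ B, r B = hpPhi ((star (B : Matrix (Fin (n + 3)) (Fin (n + 3)) ℂ)).mulVec h) := by
    intro B
    have hB : star (B : Matrix (Fin (n + 3)) (Fin (n + 3)) ℂ) ∈
        Matrix.unitaryGroup (Fin (n + 3)) ℂ := (star B).2
    rw [hr, hpPhi, hp_N_unitary _ hB, show hpN h = 1 from hh, Real.sqrt_one, div_one]
    rfl
  simp only [hr']
  obtain ⟨lam, hlam, C, hC⟩ := hp_haar n
  obtain ⟨hb0, hb1⟩ := hp_ball lam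
  have hav := fun A hA => (hp_avg n h hh μ hinv lam A hA).trans (hC A hA)
  let K : ℝ := 2 * ((n:ℝ) + 2) * ((n:ℝ) + 1)
  have hI : ∀ A : Set ℝ, MeasurableSet A →
      ENNReal.ofReal (∫ u in A ∩ Set.Ioo (0:ℝ) 1, K * u ^ 3 * (1 - u ^ 2) ^ n) =
      ENNReal.ofReal K *
        ∫⁻ u in A ∩ Set.Ioo 0 1, ENNReal.ofReal (u ^ 3 * (1 - u ^ 2) ^ n) := by
    intro A hA
    have hm : MeasurableSet (A ∩ Set.Ioo (0:ℝ) 1) := hA.inter measurableSet_Ioo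
    rw [ofReal_integral_eq_lintegral_ofReal, ← lintegral_const_mul _ (by fun_prop)]
    · refine lintegral_congr fun u => ?_
      rw [← ENNReal.ofReal_mul (by positivity), mul_assoc]
    · have : IntegrableOn (fun u : ℝ => K * u ^ 3 * (1 - u ^ 2) ^ n) (Set.Icc 0 1) :=
        Continuous.integrableOn_Icc (by fun_prop)
      exact this.mono_set fun u hu => ⟨hu.2.1.le, hu.2.2.le⟩
    · filter_upwards [ae_restrict_mem hm] with u hu
      have h0 := hu.2.1
      have h1 : 0 ≤ 1 - u ^ 2 := by nlinarith [hu.2.2]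
      simp only [Pi.zero_apply]
      positivity
  have hK : (∫ u in A ∩ Set.Ioo (0:ℝ) 1, 2 * (((n + 3 : ℕ):ℝ) - 1) * (((n + 3 : ℕ):ℝ) - 2) * u ^ 3
      * (1 - u ^ 2) ^ (n + 3 - 3)) = ∫ u in A ∩ Set.Ioo (0:ℝ) 1, K * u ^ 3 * (1 - u ^ 2) ^ n := by
    have : 2 * (((n + 3 : ℕ):ℝ) - 1) * (((n + 3 : ℕ):ℝ) - 2) = K := by
      simp only [K]; push_cast; ring
    rw [this, Nat.add_sub_cancel]
  rw [hK, hI A hA]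
  have hU := hI Set.univ MeasurableSet.univ
  have hT := hav Set.univ MeasurableSet.univ
  rw [Set.univ_inter] at hU hT
  rw [hp_total, ENNReal.ofReal_one] at hU
  simp only [Set.mem_univ, Set.ofPred_true, measure_univ, one_mul] at hT
  have hCb : C = lam {v | hpN v ≤ 1} * ENNReal.ofReal K := by
    rw [hT, mul_assoc, mul_comm _ (ENNReal.ofReal K), ← hU, mul_one]
  have hA' := hav A hA
  rw [hCb, mul_comm, mul_assoc] at hA'
  exact (ENNReal.mul_right_inj hb0 hb1).1 hA'
end

section
/- Let M ≥ 3 be an integer, let h ∈ ℂ^M be a fixed unit vector, and let B be a random unitary M×M matrix distributed according to the Haar probability measure on the unitary group U(M), with b₁, b₂ its first two columns. Then for every real s ≥ 0, the gap log₂(1+s) − E_B[ log₂(1 + (M s/2)(|⟨b₁, h⟩|² + |⟨b₂, h⟩|²)) ] equals 2(M−1)(M−2) ∫₀¹ log₂( (1+s) / (1 + (M s/2) u²) ) · u³ (1−u²)^{M−3} du. -/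
open MeasureTheory
open scoped ENNReal

lemma radial_lintegral {E : Type*} [NormedAddCommGroup E] [NormedSpace ℝ E] [MeasurableSpace E]
    [BorelSpace E] [FiniteDimensional ℝ E] [Nontrivial E] (μ : Measure E) [μ.IsAddHaarMeasure]
    (f : ℝ → ℝ≥0∞) (hf : Measurable f) :
    ∫⁻ x, f ‖x‖ ∂μ = μ.toSphere Set.univ *
      ∫⁻ y in Set.Ioi (0 : ℝ), ENNReal.ofReal (y ^ (Module.finrank ℝ E - 1)) * f y := by
  calc
    ∫⁻ x, f (‖x‖) ∂μ = ∫⁻ x : ({(0)}ᶜ : Set E), f (‖x.1‖) ∂(μ.comap (↑)) := by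
      rw [lintegral_subtype_comap (measurableSet_singleton _).compl fun x ↦ f (‖x‖),
        restrict_compl_singleton]
    _ = ∫⁻ x, f x.2 ∂μ.toSphere.prod (.volumeIoiPow (Module.finrank ℝ E - 1)) := by
      simpa using μ.measurePreserving_homeomorphUnitSphereProd.lintegral_comp_emb
        (Homeomorph.measurableEmbedding _) (f ∘ Subtype.val ∘ Prod.snd)
    _ = μ.toSphere Set.univ * ∫⁻ x : Set.Ioi (0 : ℝ), f x ∂.volumeIoiPow (Module.finrank ℝ E - 1) := by
      rw [lintegral_prod _ (by fun_prop)]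
      simp [mul_comm]
    _ = _ := by
      simp only [Measure.volumeIoiPow]
      rw [lintegral_withDensity_eq_lintegral_mul _ (by fun_prop) (by fun_prop)]
      congr 1
      exact lintegral_subtype_comap measurableSet_Ioi
        fun a ↦ ENNReal.ofReal (a ^ (Module.finrank ℝ E - 1)) * f a

lemma radial_pi (ι : Type*) [Fintype ι] [Nonempty ι] : ∃ C : ℝ≥0∞, 
    ∀ f : ℝ → ℝ≥0∞, Measurable f →
    ∫⁻ x : ι → ℂ, f (∑ i, ‖x i‖ ^ 2) = C *
      ∫⁻ y in Set.Ioi (0 : ℝ), ENNReal.ofReal (y ^ (2 * Fintype.card ι - 1)) * f (y ^ 2) := by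
  let e := (PiLp.continuousLinearEquiv 2 ℝ (fun _ : ι => ℂ)).symm
  let ν : Measure (EuclideanSpace ℂ ι) := Measure.map e volume
  have : ν.IsAddHaarMeasure := e.isAddHaarMeasure_map volume
  refine ⟨ν.toSphere Set.univ, fun f hf => ?_⟩
  have h1 := radial_lintegral ν (fun r => f (r ^ 2)) (by fun_prop)
  have hd : Module.finrank ℝ (EuclideanSpace ℂ ι) = 2 * Fintype.card ι := by
    rw [← e.toLinearEquiv.finrank_eq]
    rw [Module.finrank_pi_fintype]
    simp [mul_comm]
  rw [hd] at h1
  rw [← h1, lintegral_map (by fun_prop) e.continuous.measurable]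
  congr with x
  rw [EuclideanSpace.norm_eq, Real.sq_sqrt (by positivity)]
  rfl

lemma unitary_mp (M : ℕ) (B : Matrix.unitaryGroup (Fin M) ℂ) :
    MeasurePreserving (fun x : Fin M → ℂ => (star (B : Matrix (Fin M) (Fin M) ℂ)).mulVec x) := by
  let f : (Fin M → ℂ) →ₗ[ℝ] (Fin M → ℂ) :=
    (Matrix.toLin' (star (B : Matrix (Fin M) (Fin M) ℂ))).restrictScalars ℝ
  have hdet : ‖(star (B : Matrix (Fin M) (Fin M) ℂ)).det‖ = 1 := by
    have := Matrix.det_of_mem_unitary (star B).2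
    exact CStarRing.norm_of_mem_unitary this
  have hd : |LinearMap.det f| = 1 := by
    rw [LinearMap.det_restrictScalars, LinearMap.det_toLin', Algebra.norm_complex_eq]
    have : Complex.normSq (star (B : Matrix (Fin M) (Fin M) ℂ)).det = 1 := by
      rw [Complex.normSq_eq_norm_sq, hdet]; simp
    exact (congrArg abs this).trans abs_one
  have h0 : LinearMap.det f ≠ 0 := by intro h; simp [h] at hd
  have := Measure.map_linearMap_addHaar_eq_smul_addHaar (volume : Measure (Fin M → ℂ)) h0
  rw [abs_inv, hd] at this
  have h2 : Measure.map f (volume : Measure (Fin M → ℂ)) = volume := by simpa using this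
  refine ⟨?_, h2⟩
  exact (LinearMap.continuous_of_finiteDimensional f).measurable

lemma col_exists (M : ℕ) (hM : 0 < M) (x : Fin M → ℂ) (hx : ∑ k, ‖x k‖ ^ 2 = 1) :
    ∃ U : Matrix.unitaryGroup (Fin M) ℂ,
      (U : Matrix (Fin M) (Fin M) ℂ).mulVec (Pi.single ⟨0, hM⟩ 1) = x := by
  let v : Fin M → EuclideanSpace ℂ (Fin M) := fun _ => WithLp.toLp 2 x
  have hv : Orthonormal ℂ (Set.domRestrict {(⟨0, hM⟩ : Fin M)} v) := by
    constructor
    · intro i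
      have : ‖v i‖ = 1 := by simp [v, EuclideanSpace.norm_eq, hx]
      exact this
    · intro i j hij
      exact absurd (Subsingleton.elim i j) hij
  obtain ⟨b, hb⟩ := hv.exists_orthonormalBasis_extension_of_card_eq (by simp)
  refine ⟨⟨_, (EuclideanSpace.basisFun (Fin M) ℂ).toMatrix_orthonormalBasis_mem_unitary b⟩, ?_⟩
  have := hb ⟨0, hM⟩ rfl
  ext i
  simp [Module.Basis.toMatrix_apply, this, v]

lemma polar_piece (m : ℕ) (hm : 1 ≤ m) (Φ w : ℝ → ℝ≥0∞) (hΦ : Measurable Φ) (hw : Measurable w) :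
    ∫⁻ b in Set.Ioi (0:ℝ), ∫⁻ a in Set.Ioi (0:ℝ), ENNReal.ofReal (b ^ (2 * m - 1)) *
      (ENNReal.ofReal (a ^ 3) * (Φ (a ^ 2 / (a ^ 2 + b ^ 2)) * w (a ^ 2 + b ^ 2)))
    = (∫⁻ r in Set.Ioi (0:ℝ), ENNReal.ofReal (r ^ (2 * m + 3)) * w (r ^ 2)) *
      ∫⁻ u in Set.Ioo (0:ℝ) 1, ENNReal.ofReal (u ^ 3 * (1 - u ^ 2) ^ (m - 1)) * Φ (u ^ 2) := by
  let F : ℝ × ℝ → ℝ≥0∞ := fun p => ENNReal.ofReal (p.1 ^ (2 * m - 1)) *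
      (ENNReal.ofReal (p.2 ^ 3) * (Φ (p.2 ^ 2 / (p.2 ^ 2 + p.1 ^ 2)) * w (p.2 ^ 2 + p.1 ^ 2)))
  have hF : Measurable F := by fun_prop
  have hS : MeasurableSet (Set.Ioi (0:ℝ) ×ˢ Set.Ioi (0:ℝ)) := measurableSet_Ioi.prod measurableSet_Ioi
  let G : ℝ → ℝ≥0∞ := fun r => ENNReal.ofReal (r ^ (2 * m + 3)) * w (r ^ 2)
  let H0 : ℝ → ℝ≥0∞ := fun t => ENNReal.ofReal (Real.cos t) *
     (ENNReal.ofReal (Real.sin t ^ 3 * (1 - Real.sin t ^ 2) ^ (m - 1)) * Φ (Real.sin t ^ 2))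
  let H : ℝ → ℝ≥0∞ := (Set.Ioo 0 (Real.pi / 2)).indicator H0
  have hG : Measurable G := by fun_prop
  have hH0 : Measurable H0 := by fun_prop
  have hH : Measurable H := hH0.indicator measurableSet_Ioo
  have h1 : ∫⁻ b in Set.Ioi (0:ℝ), ∫⁻ a in Set.Ioi (0:ℝ), F (b, a)
      = ∫⁻ p, (Set.Ioi (0:ℝ) ×ˢ Set.Ioi (0:ℝ)).indicator F p := by
    rw [lintegral_indicator hS, Measure.volume_eq_prod, ← Measure.prod_restrict,
      lintegral_prod _ hF.aemeasurable]
  have h2 : ∀ p ∈ polarCoord.target, ENNReal.ofReal p.1 •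
      (Set.Ioi (0:ℝ) ×ˢ Set.Ioi (0:ℝ)).indicator F (polarCoord.symm p) = G p.1 * H p.2 := by
    rintro ⟨r, t⟩ ⟨hr, ht⟩
    simp only [Set.mem_Ioi, Set.mem_Ioo] at hr ht
    simp only [polarCoord_symm_apply, smul_eq_mul]
    by_cases h : t ∈ Set.Ioo 0 (Real.pi / 2)
    · have hs : 0 < Real.sin t := Real.sin_pos_of_pos_of_lt_pi h.1 ht.2
      have hc : 0 < Real.cos t := Real.cos_pos_of_mem_Ioo ⟨by linarith [h.1, Real.pi_pos], h.2⟩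
      rw [Set.indicator_of_mem (show (r * Real.cos t, r * Real.sin t) ∈
        Set.Ioi (0:ℝ) ×ˢ Set.Ioi (0:ℝ) from ⟨mul_pos hr hc, mul_pos hr hs⟩)]
      simp only [H, Set.indicator_of_mem h, F, G, H0]
      have e1 : (r * Real.sin t) ^ 2 + (r * Real.cos t) ^ 2 = r ^ 2 := by
        have := Real.sin_sq_add_cos_sq t
        linear_combination r ^ 2 * this
      have e2 : (r * Real.sin t) ^ 2 / r ^ 2 = Real.sin t ^ 2 := by
        field_simp
      rw [e1, e2, ← Real.cos_sq']
      have e3 : ENNReal.ofReal r * (ENNReal.ofReal ((r * Real.cos t) ^ (2 * m - 1)) *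
          ENNReal.ofReal ((r * Real.sin t) ^ 3)) = ENNReal.ofReal (r ^ (2 * m + 3)) *
          (ENNReal.ofReal (Real.cos t) *
          ENNReal.ofReal (Real.sin t ^ 3 * (Real.cos t ^ 2) ^ (m - 1))) := by
        rw [← ENNReal.ofReal_mul (by positivity), ← ENNReal.ofReal_mul (by positivity),
          ← ENNReal.ofReal_mul (by positivity), ← ENNReal.ofReal_mul (by positivity)]
        congr 1
        obtain ⟨k, rfl⟩ : ∃ k, m = k + 1 := ⟨m - 1, by omega⟩
        simp only [show 2 * (k + 1) - 1 = 2 * k + 1 by omega, Nat.add_sub_cancel]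
        ring
      calc _ = (ENNReal.ofReal r * (ENNReal.ofReal ((r * Real.cos t) ^ (2 * m - 1)) *
          ENNReal.ofReal ((r * Real.sin t) ^ 3))) * (Φ (Real.sin t ^ 2) * w (r ^ 2)) := by ring
        _ = _ := by rw [e3]; ring
    · have : (r * Real.cos t, r * Real.sin t) ∉ Set.Ioi (0:ℝ) ×ˢ Set.Ioi (0:ℝ) := by
        rintro ⟨hc, hs⟩
        simp only [Set.mem_Ioi] at hc hs
        have hc' := (pos_iff_pos_of_mul_pos hc).1 hr
        have hs' := (pos_iff_pos_of_mul_pos hs).1 hr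
        apply h
        constructor
        · by_contra h0
          exact absurd hs' (not_lt.2 (Real.sin_nonpos_of_nonpos_of_neg_pi_le (not_lt.1 h0) ht.1.le))
        · by_contra h0
          exact absurd hc' (not_lt.2 (Real.cos_nonpos_of_pi_div_two_le_of_le (not_lt.1 h0)
            (by linarith [ht.2, Real.pi_pos])))
      simp [H, Set.indicator_of_notMem this, Set.indicator_of_notMem h]
  have h3 : ∫⁻ t in Set.Ioo (-Real.pi) Real.pi, H t =
      ∫⁻ u in Set.Ioo (0:ℝ) 1, ENNReal.ofReal (u ^ 3 * (1 - u ^ 2) ^ (m - 1)) * Φ (u ^ 2) := by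
    have him : Real.sin '' Set.Ioo 0 (Real.pi / 2) = Set.Ioo 0 1 := by
      ext u
      constructor
      · rintro ⟨t, ht, rfl⟩
        have hc : 0 < Real.cos t := Real.cos_pos_of_mem_Ioo ⟨by linarith [ht.1, Real.pi_pos], ht.2⟩
        refine ⟨Real.sin_pos_of_pos_of_lt_pi ht.1 (by linarith [ht.2, Real.pi_pos]), ?_⟩
        nlinarith [Real.sin_sq_add_cos_sq t]
      · rintro ⟨h0, h1⟩
        exact ⟨Real.arcsin u, ⟨Real.arcsin_pos.2 h0, Real.arcsin_lt_pi_div_two.2 h1⟩,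
          Real.sin_arcsin (by linarith) h1.le⟩
    have hinj : Set.InjOn Real.sin (Set.Ioo 0 (Real.pi / 2)) :=
      Real.injOn_sin.mono (Set.Ioo_subset_Icc_self.trans
        (Set.Icc_subset_Icc_left (by linarith [Real.pi_pos])))
    rw [← him, lintegral_image_eq_lintegral_abs_deriv_mul measurableSet_Ioo
      (fun x _ => (Real.hasDerivAt_sin x).hasDerivWithinAt) hinj]
    rw [← lintegral_indicator measurableSet_Ioo, ← lintegral_indicator measurableSet_Ioo]
    congr 1 with t
    by_cases h : t ∈ Set.Ioo 0 (Real.pi / 2)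
    · have hc : 0 < Real.cos t := Real.cos_pos_of_mem_Ioo ⟨by linarith [h.1, Real.pi_pos], h.2⟩
      rw [Set.indicator_of_mem h, Set.indicator_of_mem (show t ∈ Set.Ioo (-Real.pi) Real.pi from
        ⟨by linarith [h.1, Real.pi_pos], by linarith [h.2, Real.pi_pos]⟩)]
      simp only [H, Set.indicator_of_mem h, H0, abs_of_pos hc]
    · rw [Set.indicator_of_notMem h, Set.indicator_apply_eq_zero]
      intro _
      exact Set.indicator_of_notMem h _
  change ∫⁻ b in Set.Ioi (0:ℝ), ∫⁻ a in Set.Ioi (0:ℝ), F (b, a) = _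
  rw [h1, ← lintegral_comp_polarCoord_symm, setLIntegral_congr_fun
    polarCoord.open_target.measurableSet h2, polarCoord_target, Measure.volume_eq_prod,
    ← Measure.prod_restrict, lintegral_prod_mul hG.aemeasurable hH.aemeasurable, h3]

noncomputable def qf {M : ℕ} (hq : 0 < M ∧ 1 < M) (x : Fin M → ℂ) : ℝ :=
  ‖x ⟨0, hq.1⟩‖ ^ 2 + ‖x ⟨1, hq.2⟩‖ ^ 2

noncomputable def nf {M : ℕ} (x : Fin M → ℂ) : ℝ := ∑ k, ‖x k‖ ^ 2

lemma beta_form (M : ℕ) (hM : 3 ≤ M) (hq : 0 < M ∧ 1 < M) (w : ℝ → ℝ≥0∞) (hw : Measurable w) :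
    ∃ K : ℝ≥0∞, ∀ Φ : ℝ → ℝ≥0∞, Measurable Φ →
      ∫⁻ x : Fin M → ℂ, Φ (qf hq x / nf x) * w (nf x) =
      K * ∫⁻ u in Set.Ioo (0:ℝ) 1, ENNReal.ofReal (u ^ 3 * (1 - u ^ 2) ^ (M - 3)) * Φ (u ^ 2) := by
  let p : Fin M → Prop := fun i => i.1 < 2
  have : Nonempty {i // p i} := ⟨⟨⟨0, by omega⟩, by simp [p]⟩⟩
  have : Nonempty {i // ¬ p i} := ⟨⟨⟨2, by omega⟩, by simp [p]⟩⟩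
  have hc1 : Fintype.card {i // p i} = 2 := by
    rw [Fintype.card_subtype]
    have : (Finset.univ.filter p) = {(⟨0, by omega⟩ : Fin M), (⟨1, by omega⟩ : Fin M)} := by
      ext i; simp [p, Fin.ext_iff]; omega
    rw [this, Finset.card_pair (by simp)]
  have hc2 : Fintype.card {i // ¬ p i} = M - 2 := by
    rw [Fintype.card_subtype_compl, hc1, Fintype.card_fin]
  obtain ⟨C1, h1⟩ := radial_pi {i // p i}
  obtain ⟨C2, h2⟩ := radial_pi {i // ¬ p i}
  rw [hc1] at h1
  rw [hc2] at h2
  have hqs : ∀ x : Fin M → ℂ, qf hq x = ∑ i : {i // p i}, ‖x i‖ ^ 2 := by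
    intro x
    rw [← Finset.sum_subtype (p := p) {(⟨0, by omega⟩ : Fin M), (⟨1, by omega⟩ : Fin M)} (by
      intro i; simp [p, Fin.ext_iff]; omega) (fun i => ‖x i‖ ^ 2), Finset.sum_pair (by simp)]
    rfl
  have hn : ∀ x : Fin M → ℂ, nf x = (∑ i : {i // p i}, ‖x i‖ ^ 2) + ∑ i : {i // ¬ p i}, ‖x i‖ ^ 2 := by
    intro x
    exact (Fintype.sum_subtype_add_sum_subtype p (fun i => ‖x i‖ ^ 2)).symm
  refine ⟨C1 * C2 * ∫⁻ r in Set.Ioi (0:ℝ), ENNReal.ofReal (r ^ (2 * (M - 2) + 3)) * w (r ^ 2), fun Φ hΦ => ?_⟩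
  have mp := volume_preserving_piEquivPiSubtypeProd (fun _ : Fin M => ℂ) p
  let T : ℝ → ℝ → ℝ≥0∞ := fun a b => Φ (a / (a + b)) * w (a + b)
  have hT : Measurable (Function.uncurry T) := by
    unfold T Function.uncurry; fun_prop
  have s1 : ∫⁻ x : Fin M → ℂ, Φ (qf hq x / nf x) * w (nf x) =
      ∫⁻ z : ({i // p i} → ℂ) × ({i // ¬ p i} → ℂ), T (∑ i, ‖z.1 i‖ ^ 2) (∑ i, ‖z.2 i‖ ^ 2) := by
    rw [← mp.lintegral_comp_emb (MeasurableEquiv.measurableEmbedding _)]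
    congr 1 with x
    rw [hqs, hn]
    rfl
  have s2 : ∀ b : ℝ, ∫⁻ y : {i // p i} → ℂ, T (∑ i, ‖y i‖ ^ 2) b = C1 *
      ∫⁻ a in Set.Ioi (0:ℝ), ENNReal.ofReal (a ^ 3) * T (a ^ 2) b := fun b =>
    h1 (fun a => T a b) (hT.comp (measurable_id.prodMk measurable_const))
  rw [s1, Measure.volume_eq_prod, lintegral_prod_symm _ (by
    have : Measurable fun z : ({i // p i} → ℂ) × ({i // ¬ p i} → ℂ) =>
      ((∑ i, ‖z.1 i‖ ^ 2), (∑ i, ‖z.2 i‖ ^ 2)) := by fun_prop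
    exact (hT.comp this).aemeasurable)]
  simp only [s2]
  have hT2 : Measurable (Function.uncurry fun (b a : ℝ) => ENNReal.ofReal (a ^ 3) * T (a ^ 2) b) := by
    have : Measurable fun z : ℝ × ℝ => (z.2 ^ 2, z.1) := by fun_prop
    have h8 := hT.comp this
    exact Measurable.mul (by fun_prop) h8
  have hI : Measurable fun b : ℝ => ∫⁻ a in Set.Ioi (0:ℝ), ENNReal.ofReal (a ^ 3) * T (a ^ 2) b :=
    hT2.lintegral_prod_right'
  rw [h2 (fun b => C1 * ∫⁻ a in Set.Ioi (0:ℝ), ENNReal.ofReal (a ^ 3) * T (a ^ 2) b)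
    (hI.const_mul C1)]
  have pp := polar_piece (M - 2) (by omega) Φ w hΦ hw
  rw [show M - 2 - 1 = M - 3 by omega] at pp
  have e1 : ∀ b : ℝ, ENNReal.ofReal (b ^ (2 * (M - 2) - 1)) *
      (C1 * ∫⁻ a in Set.Ioi (0:ℝ), ENNReal.ofReal (a ^ 3) * T (a ^ 2) (b ^ 2)) =
      C1 * ∫⁻ a in Set.Ioi (0:ℝ), ENNReal.ofReal (b ^ (2 * (M - 2) - 1)) *
      (ENNReal.ofReal (a ^ 3) * (Φ (a ^ 2 / (a ^ 2 + b ^ 2)) * w (a ^ 2 + b ^ 2))) := by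
    intro b
    have h5 : Measurable fun a : ℝ => (b ^ 2, a) := by fun_prop
    have h6 : Measurable fun a : ℝ => ENNReal.ofReal (a ^ 3) * T (a ^ 2) (b ^ 2) := by
      have h7 := hT2.comp h5
      exact h7
    rw [mul_left_comm, ← lintegral_const_mul (ENNReal.ofReal (b ^ (2 * (M - 2) - 1))) h6]
  have hm : Measurable fun b : ℝ => ∫⁻ a in Set.Ioi (0:ℝ), ENNReal.ofReal (b ^ (2 * (M - 2) - 1)) *
      (ENNReal.ofReal (a ^ 3) * (Φ (a ^ 2 / (a ^ 2 + b ^ 2)) * w (a ^ 2 + b ^ 2))) := by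
    have : Measurable (Function.uncurry fun (b a : ℝ) => ENNReal.ofReal (b ^ (2 * (M - 2) - 1)) *
      (ENNReal.ofReal (a ^ 3) * (Φ (a ^ 2 / (a ^ 2 + b ^ 2)) * w (a ^ 2 + b ^ 2)))) := by
      unfold Function.uncurry; fun_prop
    exact this.lintegral_prod_right'
  simp only [e1]
  rw [lintegral_const_mul _ hm, pp]
  ring

section
variable {M : ℕ} [MeasurableSpace (Matrix.unitaryGroup (Fin M) ℂ)]
    [BorelSpace (Matrix.unitaryGroup (Fin M) ℂ)]

lemma entry_meas (k j : Fin M) :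
    Measurable (fun B : Matrix.unitaryGroup (Fin M) ℂ => (B : Matrix (Fin M) (Fin M) ℂ) k j) := by
  apply Continuous.measurable
  exact (continuous_apply j).comp ((continuous_apply k).comp continuous_subtype_val)

lemma act_meas : Measurable (fun z : Matrix.unitaryGroup (Fin M) ℂ × (Fin M → ℂ) =>
    (star (z.1 : Matrix (Fin M) (Fin M) ℂ)).mulVec z.2) := by
  rw [measurable_pi_iff]
  intro j
  simp only [Matrix.mulVec, dotProduct, Matrix.star_apply]
  refine Finset.measurable_fun_sum _ fun k _ => ?_
  have h1 : Measurable fun z : Matrix.unitaryGroup (Fin M) ℂ × (Fin M → ℂ) =>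
    (z.1 : Matrix (Fin M) (Fin M) ℂ) k j := (entry_meas k j).comp measurable_fst
  have h2 : Measurable fun z : ℂ => star z := continuous_star.measurable
  exact (h2.comp h1).mul (by fun_prop)

lemma act_meas' (y : Fin M → ℂ) : Measurable (fun B : Matrix.unitaryGroup (Fin M) ℂ =>
    (star (B : Matrix (Fin M) (Fin M) ℂ)).mulVec y) := by
  have h : Measurable fun B : Matrix.unitaryGroup (Fin M) ℂ => (B, y) := by fun_prop
  have h2 := act_meas.comp h
  exact h2

lemma unit_const (hM : 0 < M) (μ : Measure (Matrix.unitaryGroup (Fin M) ℂ))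
    (hinv : ∀ g : Matrix.unitaryGroup (Fin M) ℂ, Measure.map (fun B => g * B) μ = μ)
    (Ψ : (Fin M → ℂ) → ℝ≥0∞) (hΨ : Measurable Ψ) (x : Fin M → ℂ) (hx : ∑ k, ‖x k‖ ^ 2 = 1) :
    ∫⁻ B, Ψ ((star (B : Matrix (Fin M) (Fin M) ℂ)).mulVec x) ∂μ =
    ∫⁻ B, Ψ ((star (B : Matrix (Fin M) (Fin M) ℂ)).mulVec (Pi.single ⟨0, hM⟩ 1)) ∂μ := by
  obtain ⟨U, hU⟩ := col_exists M hM x hx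
  have hm : ∀ y, Measurable fun B : Matrix.unitaryGroup (Fin M) ℂ =>
      Ψ ((star (B : Matrix (Fin M) (Fin M) ℂ)).mulVec y) := fun y =>
    hΨ.comp (act_meas' y)
  have hg : Measurable fun B : Matrix.unitaryGroup (Fin M) ℂ => U * B :=
    (continuous_const.mul continuous_id).measurable
  conv_lhs => rw [← hinv U, lintegral_map (hm x) hg]
  congr 1 with B
  congr 1
  rw [← hU, Matrix.mulVec_mulVec]
  congr 1
  have := U.2.1
  simp only [Submonoid.coe_mul, star_mul, mul_assoc, this, mul_one]

lemma nf_unitary (B : Matrix.unitaryGroup (Fin M) ℂ) (x : Fin M → ℂ) :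
    nf ((star (B : Matrix (Fin M) (Fin M) ℂ)).mulVec x) = nf x := by
  have key : ∀ y : Fin M → ℂ, ((nf y : ℝ) : ℂ) = dotProduct (star y) y := by
    intro y
    simp [nf, dotProduct, Complex.conj_mul']
  have : ((nf ((star (B : Matrix (Fin M) (Fin M) ℂ)).mulVec x) : ℝ) : ℂ) = (nf x : ℝ) := by
    rw [key, key, Matrix.star_mulVec, Matrix.dotProduct_mulVec, Matrix.vecMul_vecMul]
    have h2 : (star (B : Matrix (Fin M) (Fin M) ℂ)).conjTranspose *
        star (B : Matrix (Fin M) (Fin M) ℂ) = 1 := by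
      rw [← Matrix.star_eq_conjTranspose, star_star]; exact B.2.2
    rw [h2, Matrix.vecMul_one]
  exact_mod_cast this

lemma qf_smul (hq : 0 < M ∧ 1 < M) (c : ℝ) (x : Fin M → ℂ) : qf hq ((c : ℂ) • x) = c ^ 2 * qf hq x := by
  simp [qf, mul_pow]; ring

lemma nf_smul (c : ℝ) (x : Fin M → ℂ) : nf ((c : ℂ) • x) = c ^ 2 * nf x := by
  simp [nf, mul_pow, Finset.mul_sum]

lemma qf_meas (hq : 0 < M ∧ 1 < M) : Measurable (qf hq) := by unfold qf; fun_prop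
lemma nf_meas : Measurable (nf : (Fin M → ℂ) → ℝ) := by unfold nf; fun_prop

lemma key_id (hq : 0 < M ∧ 1 < M) (μ : Measure (Matrix.unitaryGroup (Fin M) ℂ)) [IsProbabilityMeasure μ]
    (hinv : ∀ g : Matrix.unitaryGroup (Fin M) ℂ, Measure.map (fun B => g * B) μ = μ)
    (h : Fin M → ℂ) (hh : ∑ k, ‖h k‖ ^ 2 = 1)
    (Φ w : ℝ → ℝ≥0∞) (hΦ : Measurable Φ) (hw : Measurable w) :
    (∫⁻ B, Φ (qf hq ((star (B : Matrix (Fin M) (Fin M) ℂ)).mulVec h)) ∂μ) *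
      ∫⁻ x : Fin M → ℂ, w (nf x) = ∫⁻ x : Fin M → ℂ, Φ (qf hq x / nf x) * w (nf x) := by
  set E := ∫⁻ B, Φ (qf hq ((star (B : Matrix (Fin M) (Fin M) ℂ)).mulVec h)) ∂μ with hE
  have hqm := qf_meas hq
  have hnm := nf_meas (M := M)
  have am := act_meas (M := M)
  have c1 : ∀ x : Fin M → ℂ, x ≠ 0 → ∫⁻ B, Φ (qf hq ((star (B : Matrix (Fin M) (Fin M) ℂ)).mulVec x)
      / nf x) ∂μ = E := by
    intro x hx
    have hpos : 0 < nf x := by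
      obtain ⟨i, hi⟩ := Function.ne_iff.1 hx
      exact Finset.sum_pos' (fun _ _ => by positivity) ⟨i, Finset.mem_univ _, by
        have : 0 < ‖x i‖ := norm_pos_iff.2 hi
        positivity⟩
    have hc : ((√(nf x))⁻¹) ^ 2 = (nf x)⁻¹ := by
      rw [inv_pow, Real.sq_sqrt hpos.le]
    have hu : nf ((((√(nf x))⁻¹ : ℝ) : ℂ) • x) = 1 := by
      rw [nf_smul, hc, inv_mul_cancel₀ hpos.ne']
    rw [hE, unit_const hq.1 μ hinv (fun y => Φ (qf hq y)) (hΦ.comp hqm) h hh,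
      ← unit_const hq.1 μ hinv (fun y => Φ (qf hq y)) (hΦ.comp hqm) _ hu]
    congr 1 with B
    rw [Matrix.mulVec_smul, qf_smul, hc, div_eq_inv_mul]
  have c2 : E * ∫⁻ x : Fin M → ℂ, w (nf x) = ∫⁻ x : Fin M → ℂ, ∫⁻ B,
      Φ (qf hq ((star (B : Matrix (Fin M) (Fin M) ℂ)).mulVec x) / nf x) * w (nf x) ∂μ := by
    rw [← lintegral_const_mul E (f := fun x : Fin M → ℂ => w (nf x)) (hw.comp hnm)]
    have : Nonempty (Fin M) := ⟨⟨0, by omega⟩⟩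
    apply lintegral_congr_ae
    have h0 : ∀ᵐ x : Fin M → ℂ, x ≠ 0 := by
      rw [ae_iff]; simp
    filter_upwards [h0] with x hx
    rw [lintegral_mul_const, c1 x hx]
    exact hΦ.comp ((hqm.comp (act_meas' x)).div_const _)
  rw [c2, lintegral_lintegral_swap]
  · have : ∀ B : Matrix.unitaryGroup (Fin M) ℂ, ∫⁻ x : Fin M → ℂ,
      Φ (qf hq ((star (B : Matrix (Fin M) (Fin M) ℂ)).mulVec x) / nf x) * w (nf x) =
      ∫⁻ x : Fin M → ℂ, Φ (qf hq x / nf x) * w (nf x) := by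
      intro B
      rw [← (unitary_mp M B).lintegral_comp (f := fun x => Φ (qf hq x / nf x) * w (nf x))
        (by fun_prop)]
      simp only [nf_unitary]
    simp [this]
  · have hsw : Measurable fun z : (Fin M → ℂ) × Matrix.unitaryGroup (Fin M) ℂ => (z.2, z.1) :=
      measurable_swap
    have hs : Measurable fun z : (Fin M → ℂ) × Matrix.unitaryGroup (Fin M) ℂ =>
      qf hq ((star (z.2 : Matrix (Fin M) (Fin M) ℂ)).mulVec z.1) := by
      have h3 := hqm.comp (am.comp hsw)
      exact h3
    have hn2 : Measurable fun z : (Fin M → ℂ) × Matrix.unitaryGroup (Fin M) ℂ => nf z.1 :=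
      hnm.comp measurable_fst
    exact ((hΦ.comp (hs.div hn2)).mul (hw.comp hn2)).aemeasurable
end

lemma ball_vol (M : ℕ) (hM : 0 < M) : volume {x : Fin M → ℂ | nf x < 1} ≠ 0 ∧
    volume {x : Fin M → ℂ | nf x < 1} ≠ ∞ := by
  have hc : Continuous (nf : (Fin M → ℂ) → ℝ) := by unfold nf; fun_prop
  constructor
  · apply IsOpen.measure_ne_zero
    · exact isOpen_lt hc continuous_const
    · exact ⟨0, by simp [nf]⟩
  · refine ne_top_of_le_ne_top (measure_ball_lt_top (x := (0 : Fin M → ℂ)) (r := 2)).ne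
      (measure_mono ?_)
    intro x hx
    rw [mem_ball_zero_iff, pi_norm_lt_iff (by norm_num)]
    intro i
    have h1 : ‖x i‖ ^ 2 ≤ nf x :=
      Finset.single_le_sum (f := fun i => ‖x i‖ ^ 2) (fun _ _ => by positivity) (Finset.mem_univ i)
    have h2 : nf x < 1 := hx
    nlinarith [norm_nonneg (x i)]

lemma beta_val (n : ℕ) : ∫ u in (0:ℝ)..1, u ^ 3 * (1 - u ^ 2) ^ n =
    1 / (2 * ((n : ℝ) + 1) * (n + 2)) := by
  have hd : ∀ u ∈ Set.uIcc (0:ℝ) 1, HasDerivAt (fun u : ℝ => -(1 - u ^ 2) ^ (n + 1) / (2 * ((n : ℝ) + 1))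
      + (1 - u ^ 2) ^ (n + 2) / (2 * ((n : ℝ) + 2))) (u ^ 3 * (1 - u ^ 2) ^ n) u := by
    intro u _
    have h0 : HasDerivAt (fun u : ℝ => 1 - u ^ 2) (-(2 * u)) u := by
      simpa using (hasDerivAt_pow 2 u).const_sub 1
    have h1 := ((h0.pow (n + 1)).neg.div_const (2 * ((n : ℝ) + 1))).add
      ((h0.pow (n + 2)).div_const (2 * ((n : ℝ) + 2)))
    have h2 : u ^ 3 * (1 - u ^ 2) ^ n =
        -(((n + 1 : ℕ) : ℝ) * (1 - u ^ 2) ^ (n + 1 - 1) * -(2 * u)) / (2 * ((n : ℝ) + 1)) +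
        ((n + 2 : ℕ) : ℝ) * (1 - u ^ 2) ^ (n + 2 - 1) * -(2 * u) / (2 * ((n : ℝ) + 2)) := by
      simp only [show n + 2 - 1 = n + 1 by omega, Nat.add_sub_cancel]
      push_cast
      field_simp
      ring
    rw [h2]
    exact h1
  rw [intervalIntegral.integral_eq_sub_of_hasDerivAt hd
    (Continuous.intervalIntegrable (by fun_prop) _ _)]
  simp
  field_simp
  ring

lemma J_eq (n : ℕ) (f : ℝ → ℝ) (hf : ContinuousOn f (Set.Icc 0 1)) (hf0 : ∀ t, 0 ≤ t → 0 ≤ f t) :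
    ∫⁻ u in Set.Ioo (0:ℝ) 1, ENNReal.ofReal (u ^ 3 * (1 - u ^ 2) ^ n) * ENNReal.ofReal (f (u ^ 2))
    = ENNReal.ofReal (∫ u in (0:ℝ)..1, f (u ^ 2) * (u ^ 3 * (1 - u ^ 2) ^ n)) := by
  have hcont : ContinuousOn (fun u : ℝ => f (u ^ 2) * (u ^ 3 * (1 - u ^ 2) ^ n)) (Set.Icc 0 1) := by
    refine ContinuousOn.mul (hf.comp (by fun_prop) ?_) (by fun_prop)
    intro u hu
    exact ⟨by positivity, pow_le_one₀ hu.1 hu.2⟩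
  have hw : ∀ u ∈ Set.Ioo (0:ℝ) 1, 0 ≤ u ^ 3 * (1 - u ^ 2) ^ n := by
    intro u hu
    have h1 : 0 ≤ 1 - u ^ 2 := by nlinarith [hu.1, hu.2]
    have h2 := hu.1
    positivity
  rw [intervalIntegral.integral_of_le zero_le_one, integral_Ioc_eq_integral_Ioo,
    ofReal_integral_eq_lintegral_ofReal]
  · refine setLIntegral_congr_fun measurableSet_Ioo fun u hu => ?_
    rw [← ENNReal.ofReal_mul (hw u hu), mul_comm]
  · exact (hcont.integrableOn_compact isCompact_Icc).mono_set Set.Ioo_subset_Icc_self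
  · filter_upwards [ae_restrict_mem measurableSet_Ioo] with u hu
    exact mul_nonneg (hf0 _ (by positivity)) (hw u hu)

/-- Let `M ≥ 3`, let `h ∈ ℂ^M` be a fixed unit vector, and let `B` be a random
unitary `M×M` matrix distributed according to the Haar probability measure on `U(M)`
(characterized as a Borel probability measure invariant under left translation), with
`b₁, b₂` its first two columns. Then for every real `s ≥ 0`, the gap
`log₂(1+s) − E_B[ log₂(1 + (M s/2)(|⟨b₁, h⟩|² + |⟨b₂, h⟩|²)) ]` equals
`2(M−1)(M−2) ∫₀¹ log₂( (1+s) / (1 + (M s/2) u²) ) · u³ (1−u²)^{M−3} du`. -/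
theorem gap_formula (M : ℕ) (hM : 3 ≤ M)
    (h : Fin M → ℂ) (hh : ∑ k, ‖h k‖ ^ 2 = 1)
    [MeasurableSpace (Matrix.unitaryGroup (Fin M) ℂ)]
    [BorelSpace (Matrix.unitaryGroup (Fin M) ℂ)]
    (μ : Measure (Matrix.unitaryGroup (Fin M) ℂ)) [IsProbabilityMeasure μ]
    (hinv : ∀ g : Matrix.unitaryGroup (Fin M) ℂ,
      Measure.map (fun B => g * B) μ = μ)
    (s : ℝ) (hs : 0 ≤ s) :
    Real.logb 2 (1 + s) -
      ∫ B, Real.logb 2 (1 + (M * s / 2) *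
        (‖∑ k, (starRingEnd ℂ)
            ((B : Matrix (Fin M) (Fin M) ℂ) k ⟨0, by omega⟩) * h k‖ ^ 2
          + ‖∑ k, (starRingEnd ℂ)
            ((B : Matrix (Fin M) (Fin M) ℂ) k ⟨1, by omega⟩) * h k‖ ^ 2)) ∂μ
    = 2 * ((M:ℝ) - 1) * ((M:ℝ) - 2) *
      ∫ u in (0:ℝ)..1, Real.logb 2 ((1 + s) / (1 + (M * s / 2) * u ^ 2)) *
        u ^ 3 * (1 - u ^ 2) ^ (M - 3) := by
  set c : ℝ := M * s / 2 with hc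
  have hq : 0 < M ∧ 1 < M := by omega
  have hc0 : 0 ≤ c := by positivity
  let f : ℝ → ℝ := fun t => Real.logb 2 (1 + c * t)
  have hf0 : ∀ t, 0 ≤ t → 0 ≤ f t := fun t ht =>
    Real.logb_nonneg (by norm_num) (by nlinarith [mul_nonneg hc0 ht])
  have hfm : Measurable f := by
    have : Measurable (Real.logb 2) := by unfold Real.logb; fun_prop
    exact this.comp (by fun_prop)
  have hfc : ContinuousOn f (Set.Icc 0 1) := by
    intro t ht
    have : (1 + c * t) ≠ 0 := by nlinarith [mul_nonneg hc0 ht.1]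
    have h3 : ContinuousAt f t := by
      unfold f Real.logb
      fun_prop (disch := assumption)
    exact h3.continuousWithinAt
  set I : ℝ := ∫ u in (0:ℝ)..1, f (u ^ 2) * (u ^ 3 * (1 - u ^ 2) ^ (M - 3)) with hI
  have hcast : ((M - 3 : ℕ) : ℝ) = (M : ℝ) - 3 := by push_cast [Nat.cast_sub hM]; ring
  have hMr : (3 : ℝ) ≤ M := by exact_mod_cast hM
  -- weight
  let w : ℝ → ℝ≥0∞ := (Set.Iio (1:ℝ)).indicator 1
  have hw : Measurable w := measurable_one.indicator measurableSet_Iio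
  have hvol : ∫⁻ x : Fin M → ℂ, w (nf x) = volume {x : Fin M → ℂ | nf x < 1} := by
    have hms : MeasurableSet {x : Fin M → ℂ | nf x < 1} := nf_meas measurableSet_Iio
    rw [← lintegral_indicator_one hms]
    rfl
  obtain ⟨hv0, hvt⟩ := ball_vol M (by omega)
  obtain ⟨K, hK⟩ := beta_form M hM hq w hw
  have hJ1 := J_eq (M - 3) (fun _ => 1) continuousOn_const (fun _ _ => zero_le_one)
  have hJf := J_eq (M - 3) f hfc hf0
  rw [← hI] at hJf
  simp only [one_mul] at hJ1
  rw [beta_val, hcast] at hJ1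
  have k1 := hK (fun _ => ENNReal.ofReal 1) measurable_const
  have kf := hK (fun t => ENNReal.ofReal (f t)) hfm.ennreal_ofReal
  rw [hJ1] at k1
  rw [hJf] at kf
  simp only [ENNReal.ofReal_one, one_mul] at k1
  rw [hvol] at k1
  have kid := key_id hq μ hinv h hh (fun t => ENNReal.ofReal (f t)) w hfm.ennreal_ofReal hw
  rw [kf, hvol, k1] at kid
  have hD : (0:ℝ) < 1 / (2 * ((M : ℝ) - 3 + 1) * (M - 3 + 2)) := by
    apply one_div_pos.2
    apply mul_pos <;> nlinarith
  have hK0 : K ≠ 0 := by rintro rfl; simp at k1; exact hv0 k1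
  have hKt : K ≠ ∞ := by
    rintro rfl
    rw [ENNReal.top_mul (by simpa using hD)] at k1
    exact hvt k1
  rw [mul_left_comm, ENNReal.mul_right_inj hK0 hKt] at kid
  have hE : (∫ B, f (qf hq ((star (B : Matrix (Fin M) (Fin M) ℂ)).mulVec h)) ∂μ) *
      (1 / (2 * ((M : ℝ) - 3 + 1) * (M - 3 + 2))) = I := by
    have hI0 : 0 ≤ I := by
      apply intervalIntegral.integral_nonneg zero_le_one
      intro u hu
      have h1 : 0 ≤ 1 - u ^ 2 := by nlinarith [hu.1, hu.2]
      have h2 := hu.1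
      exact mul_nonneg (hf0 _ (by positivity)) (by positivity)
    rw [integral_eq_lintegral_of_nonneg_ae]
    · have := congrArg ENNReal.toReal kid
      rwa [ENNReal.toReal_mul, ENNReal.toReal_ofReal hD.le, ENNReal.toReal_ofReal hI0] at this
    · exact Filter.Eventually.of_forall fun B => hf0 _ (by unfold qf; positivity)
    · exact (hfm.comp ((qf_meas hq).comp
        (act_meas' h))).aestronglyMeasurable
  have hlhs : ∫ B, Real.logb 2 (1 + c *
        (‖∑ k, (starRingEnd ℂ)
            ((B : Matrix (Fin M) (Fin M) ℂ) k ⟨0, by omega⟩) * h k‖ ^ 2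
          + ‖∑ k, (starRingEnd ℂ)
            ((B : Matrix (Fin M) (Fin M) ℂ) k ⟨1, by omega⟩) * h k‖ ^ 2)) ∂μ
      = ∫ B, f (qf hq ((star (B : Matrix (Fin M) (Fin M) ℂ)).mulVec h)) ∂μ := rfl
  rw [hlhs]
  have hrhs : ∫ u in (0:ℝ)..1, Real.logb 2 ((1 + s) / (1 + c * u ^ 2)) *
        u ^ 3 * (1 - u ^ 2) ^ (M - 3) =
      Real.logb 2 (1 + s) * (1 / (2 * ((M : ℝ) - 3 + 1) * (M - 3 + 2))) - I := by
    rw [← hcast, ← beta_val, ← intervalIntegral.integral_const_mul, hI,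
      ← intervalIntegral.integral_sub]
    · apply intervalIntegral.integral_congr
      intro u _
      have h1 : (1 + s) ≠ 0 := by linarith
      have h2 : (1 + c * u ^ 2) ≠ 0 := by nlinarith [mul_nonneg hc0 (sq_nonneg u)]
      simp only [f]
      rw [Real.logb_div h1 h2]
      ring
    · exact Continuous.intervalIntegrable (by fun_prop) _ _
    · apply ContinuousOn.intervalIntegrable
      rw [Set.uIcc_of_le zero_le_one]
      refine ContinuousOn.mul (hfc.comp (by fun_prop) ?_) (by fun_prop)
      intro u hu
      exact ⟨by positivity, pow_le_one₀ hu.1 hu.2⟩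
  rw [hrhs, ← hE]
  have h1 : (M : ℝ) - 3 + 1 ≠ 0 := by linarith
  have h2 : (M : ℝ) - 3 + 2 ≠ 0 := by linarith
  rw [show (M:ℝ) - 1 = M - 3 + 2 by ring, show (M:ℝ) - 2 = M - 3 + 1 by ring]
  field_simp
end
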